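/- arXiv:2205.12623 — 4 statements merged into one kernel-verified Lean document; each statement's English description precedes it below -/
import Mathlib

section
/- Let n, μ, L, M > 0, C ≥ 0, λ ≥ 0, s ∈ (0, 1], γ ∈ (0, 1], and set ρ̃ = 1 − sγ. Let ε₁, ε₂, ε₃, ε₄ > 0 satisfy ε₂ ≥ (12Cλ/s²)ε₄, and let η̂ > 0 satisfy η̂ ≤ (s/(3M))·(γ/μ) and η̂ ≤ √(ε₂/(12(2nε₁ + 2ε₂ + ε₃))) · (sγ/L). Then (4nL²η̂²/(sγ))ε₁ + ((1 + ρ̃²)/2 + 4L²η̂²/(sγ))ε₂ + (2L²η̂²/(sγ))ε₃ + (2Cλγ/s)ε₄ ≤ (1 − (1/2)Mη̂μ)ε₂. -/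
/-- second row of the linear system of inequalities `Aε ≤ (1 - (1/2)Mη̂μ)ε`. -/
theorem stmt16 (n : ℕ) (μ L M C lam s γ ρt ε1 ε2 ε3 ε4 ηh : ℝ)
    (hn : 0 < n) (hμ : 0 < μ) (hL : 0 < L) (hM : 0 < M)
    (hC : 0 ≤ C) (hlam : 0 ≤ lam)
    (hs0 : 0 < s) (hs1 : s ≤ 1) (hγ0 : 0 < γ) (hγ1 : γ ≤ 1)
    (hρt : ρt = 1 - s * γ)
    (hε1 : 0 < ε1) (hε2 : 0 < ε2) (hε3 : 0 < ε3) (hε4 : 0 < ε4)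
    (h24 : (12 * C * lam / s ^ 2) * ε4 ≤ ε2)
    (hη0 : 0 < ηh)
    (hηa : ηh ≤ (s / (3 * M)) * (γ / μ))
    (hηb : ηh ≤ Real.sqrt (ε2 / (12 * (2 * (n : ℝ) * ε1 + 2 * ε2 + ε3))) * (s * γ / L)) :
    (4 * (n : ℝ) * L ^ 2 * ηh ^ 2 / (s * γ)) * ε1
        + ((1 + ρt ^ 2) / 2 + 4 * L ^ 2 * ηh ^ 2 / (s * γ)) * ε2
        + (2 * L ^ 2 * ηh ^ 2 / (s * γ)) * ε3
        + (2 * C * lam * γ / s) * ε4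
      ≤ (1 - (1 / 2) * M * ηh * μ) * ε2 := by
  have ht : 0 < s * γ := mul_pos hs0 hγ0
  have ht1 : s * γ ≤ 1 := mul_le_one₀ hs1 hγ0.le hγ1
  set D : ℝ := 2 * (n : ℝ) * ε1 + 2 * ε2 + ε3 with hD
  have hDpos : 0 < D := by positivity
  have gradient_term : 2 * L ^ 2 * ηh ^ 2 / (s * γ) * D ≤ s * γ / 6 * ε2 := by
    have hsq : ηh ^ 2 ≤ ε2 / (12 * D) * (s * γ / L) ^ 2 := by
      have h := pow_le_pow_left₀ hη0.le hηb 2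
      rwa [mul_pow, Real.sq_sqrt (by positivity)] at h
    calc 2 * L ^ 2 * ηh ^ 2 / (s * γ) * D
        ≤ 2 * L ^ 2 * (ε2 / (12 * D) * (s * γ / L) ^ 2) / (s * γ) * D := by gcongr
      _ = s * γ / 6 * ε2 := by field_simp; norm_num
  have compression_term : 2 * C * lam * γ / s * ε4 ≤ s * γ / 6 * ε2 := by
    calc 2 * C * lam * γ / s * ε4
        = s * γ / 6 * (12 * C * lam / s ^ 2 * ε4) := by field_simp; ring
      _ ≤ s * γ / 6 * ε2 := by gcongr
  have step_size : M * ηh * μ ≤ s * γ / 3 := by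
    calc M * ηh * μ ≤ M * (s / (3 * M) * (γ / μ)) * μ := by gcongr
      _ = s * γ / 3 := by field_simp
  have contraction : (1 + ρt ^ 2) / 2 ≤ 1 - s * γ / 2 := by
    rw [hρt]
    nlinarith
  have h_contr := mul_le_mul_of_nonneg_right contraction hε2.le
  have h_step := mul_le_mul_of_nonneg_right step_size hε2.le
  have split_sum : 4 * (n : ℝ) * L ^ 2 * ηh ^ 2 / (s * γ) * ε1
        + ((1 + ρt ^ 2) / 2 + 4 * L ^ 2 * ηh ^ 2 / (s * γ)) * ε2
        + (2 * L ^ 2 * ηh ^ 2 / (s * γ)) * ε3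
      = (1 + ρt ^ 2) / 2 * ε2 + 2 * L ^ 2 * ηh ^ 2 / (s * γ) * D := by
    rw [hD]
    ring
  rw [split_sum]
  linarith
end

section
/- Let n, μ, L, M > 0, C ≥ 0, λ ≥ 0, s ∈ (0, 1], γ ∈ (0, 1], and set ρ̃ = 1 − sγ. Let ε₁, ε₂, ε₃, ε₄, ε₅ > 0 satisfy ε₃ ≥ (12λ(3ε₂ + C(3ε₄ + ε₅)))/s², and let η̂ > 0 satisfy η̂ ≤ (s/(3M))·(γ/μ) and η̂ ≤ √(ε₃/(36(2nε₁ + 2ε₂ + ε₃))) · (sγ/L). Then (12nL²η̂²/(sγ))ε₁ + (12L²η̂²/(sγ) + 6λγ/s)ε₂ + ((1 + ρ̃²)/2 + 6L²η̂²/(sγ))ε₃ + (6Cλγ/s)ε₄ + (2Cλγ/s)ε₅ ≤ (1 − (1/2)Mη̂μ)ε₃. -/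
/-- third row of the linear system of inequalities `Aε ≤ (1 - (1/2)Mη̂μ)ε`. -/
theorem stmt17 (n : ℕ) (μ L M C lam s γ ρt ε1 ε2 ε3 ε4 ε5 ηh : ℝ)
    (hn : 0 < n) (hμ : 0 < μ) (hL : 0 < L) (hM : 0 < M)
    (hC : 0 ≤ C) (hlam : 0 ≤ lam)
    (hs0 : 0 < s) (hs1 : s ≤ 1) (hγ0 : 0 < γ) (hγ1 : γ ≤ 1)
    (hρt : ρt = 1 - s * γ)
    (hε1 : 0 < ε1) (hε2 : 0 < ε2) (hε3 : 0 < ε3) (hε4 : 0 < ε4) (hε5 : 0 < ε5)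
    (h3 : (12 * lam * (3 * ε2 + C * (3 * ε4 + ε5))) / s ^ 2 ≤ ε3)
    (hη0 : 0 < ηh)
    (hηa : ηh ≤ (s / (3 * M)) * (γ / μ))
    (hηb : ηh ≤ Real.sqrt (ε3 / (36 * (2 * (n : ℝ) * ε1 + 2 * ε2 + ε3))) * (s * γ / L)) :
    (12 * (n : ℝ) * L ^ 2 * ηh ^ 2 / (s * γ)) * ε1
        + (12 * L ^ 2 * ηh ^ 2 / (s * γ) + 6 * lam * γ / s) * ε2
        + ((1 + ρt ^ 2) / 2 + 6 * L ^ 2 * ηh ^ 2 / (s * γ)) * ε3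
        + (6 * C * lam * γ / s) * ε4
        + (2 * C * lam * γ / s) * ε5
      ≤ (1 - (1 / 2) * M * ηh * μ) * ε3 := by
  have hx : 0 < s * γ := mul_pos hs0 hγ0
  have hx1 : s * γ ≤ 1 := mul_le_one₀ hs1 hγ0.le hγ1
  have hD : 0 < 2 * (n : ℝ) * ε1 + 2 * ε2 + ε3 := by positivity
  have hρ : (1 + ρt ^ 2) / 2 * ε3 ≤ (1 - s * γ / 2) * ε3 := by
    subst hρt
    exact mul_le_mul_of_nonneg_right (by nlinarith) hε3.le
  have hstep : M * ηh * μ * ε3 ≤ s * γ / 3 * ε3 := by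
    refine mul_le_mul_of_nonneg_right ?_ hε3.le
    calc M * ηh * μ ≤ M * ((s / (3 * M)) * (γ / μ)) * μ := by gcongr
      _ = s * γ / 3 := by field_simp
  have hsmooth : 6 * L ^ 2 * ηh ^ 2 / (s * γ) * (2 * (n : ℝ) * ε1 + 2 * ε2 + ε3)
      ≤ s * γ / 6 * ε3 := by
    have hsq := pow_le_pow_left₀ hη0.le hηb 2
    rw [mul_pow, Real.sq_sqrt (by positivity)] at hsq
    calc _ ≤ 6 * L ^ 2 * (ε3 / (36 * (2 * (n : ℝ) * ε1 + 2 * ε2 + ε3)) * (s * γ / L) ^ 2)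
          / (s * γ) * (2 * (n : ℝ) * ε1 + 2 * ε2 + ε3) := by gcongr
      _ = s * γ / 6 * ε3 := by
        field_simp
        norm_num
  have hcompress : 2 * lam * γ / s * (3 * ε2 + C * (3 * ε4 + ε5)) ≤ s * γ / 6 * ε3 := by
    calc _ = s * γ / 6 * ((12 * lam * (3 * ε2 + C * (3 * ε4 + ε5))) / s ^ 2) := by
          field_simp
          ring
      _ ≤ s * γ / 6 * ε3 := by gcongr
  calc _ = 6 * L ^ 2 * ηh ^ 2 / (s * γ) * (2 * (n : ℝ) * ε1 + 2 * ε2 + ε3)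
        + 2 * lam * γ / s * (3 * ε2 + C * (3 * ε4 + ε5)) + (1 + ρt ^ 2) / 2 * ε3 := by ring
    _ ≤ _ := by linarith
end

section
/- Let n, μ, L, M > 0 with κ = L/μ, let C ≥ 0, λ ≥ 0, let t_x > 0 and c_x ∈ [0, 1), let ε₁, ε₂, ε₃, ε₄ > 0, and set m_x = t_x(2nε₁ + 2ε₂ + ε₃) + t_xλ(ε₂ + Cε₄) + Mε₄/(2κ). Suppose 0 < γ ≤ min{1, ((1 − c_x)/m_x)ε₄} and 0 < η̂ ≤ γ/L. Then 2t_x nL²η̂²ε₁ + (2t_x L²η̂² + t_xλγ²)ε₂ + t_x L²η̂²ε₃ + (c_x + t_x Cλγ²)ε₄ ≤ (1 − (1/2)Mη̂μ)ε₄. -/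
/-- fourth row of the linear system of inequalities `Aε ≤ (1 - (1/2)Mη̂μ)ε`. -/
theorem stmt18 (n : ℕ) (μ L M κ C lam tx cx ε1 ε2 ε3 ε4 mx γ ηh : ℝ)
    (hn : 0 < n) (hμ : 0 < μ) (hL : 0 < L) (hM : 0 < M)
    (hκ : κ = L / μ) (hC : 0 ≤ C) (hlam : 0 ≤ lam)
    (htx : 0 < tx) (hcx0 : 0 ≤ cx) (hcx1 : cx < 1)
    (hε1 : 0 < ε1) (hε2 : 0 < ε2) (hε3 : 0 < ε3) (hε4 : 0 < ε4)
    (hmx : mx = tx * (2 * (n : ℝ) * ε1 + 2 * ε2 + ε3) + tx * lam * (ε2 + C * ε4)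
        + M * ε4 / (2 * κ))
    (hγ0 : 0 < γ) (hγ1 : γ ≤ 1) (hγ2 : γ ≤ ((1 - cx) / mx) * ε4)
    (hη0 : 0 < ηh) (hη : ηh ≤ γ / L) :
    2 * tx * (n : ℝ) * L ^ 2 * ηh ^ 2 * ε1
        + (2 * tx * L ^ 2 * ηh ^ 2 + tx * lam * γ ^ 2) * ε2
        + tx * L ^ 2 * ηh ^ 2 * ε3
        + (cx + tx * C * lam * γ ^ 2) * ε4
      ≤ (1 - (1 / 2) * M * ηh * μ) * ε4 := by
  have hn' : (0 : ℝ) < n := Nat.cast_pos.mpr hn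
  have hκ0 : 0 < κ := hκ ▸ div_pos hL hμ
  have hmx0 : 0 < mx := by rw [hmx]; positivity
  have hγmx : γ * mx ≤ (1 - cx) * ε4 := by
    rwa [div_mul_eq_mul_div, le_div_iff₀ hmx0] at hγ2
  have hLη : L * ηh ≤ γ := by rwa [le_div_iff₀ hL, mul_comm] at hη
  have hγsq : γ ^ 2 ≤ γ := by nlinarith
  have hLηsq : L ^ 2 * ηh ^ 2 ≤ γ := by
    rw [← mul_pow]
    exact (pow_le_pow_left₀ (by positivity) hLη 2).trans hγsq
  have hημ : ηh * μ ≤ γ / κ := by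
    rw [le_div_iff₀ hκ0, hκ]
    calc ηh * μ * (L / μ) = L * ηh := by field_simp
      _ ≤ γ := hLη
  have h_grad := mul_le_mul_of_nonneg_left hLηsq
    (by positivity : 0 ≤ tx * (2 * (n : ℝ) * ε1 + 2 * ε2 + ε3))
  have h_cons := mul_le_mul_of_nonneg_left hγsq
    (by positivity : 0 ≤ tx * lam * (ε2 + C * ε4))
  have h_rate := mul_le_mul_of_nonneg_left hημ (by positivity : 0 ≤ M * ε4 / 2)
  have h_eq : M * ε4 / 2 * (γ / κ) = γ * (M * ε4 / (2 * κ)) := by ring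
  rw [hmx] at hγmx
  linarith
end

section
/- Let n, μ, L, M > 0 with κ = L/μ, C ≥ 0, λ ≥ 0, s ∈ (0, 1], δ ∈ (0, 1], r > 0, and let α_x, α_y, τ_x, τ_y satisfy 0 < α_x r ≤ 1, 0 < α_y r ≤ 1, τ_x, τ_y > 1, c_x = τ_x(1 − α_x r δ) < 1, c_y = τ_y(1 − α_y r δ) < 1, t_x = 3τ_x/(τ_x − 1), t_y = 3τ_y/(τ_y − 1). Let ε₁, …, ε₅ > 0 satisfy nε₁ ≥ (12κ²/M²)ε₃, ε₂ ≥ (12Cλ/s²)ε₄, ε₃ ≥ Mε₂, ε₃ ≥ (12λ(3ε₂ + C(3ε₄ + ε₅)))/s², and set m_x = t_x(2nε₁ + 2ε₂ + ε₃) + t_xλ(ε₂ + Cε₄) + Mε₄/(2κ) and m_y = 3t_y(2nε₁ + 2ε₂ + ε₃) + t_yλ(3ε₂ + ε₃ + 3Cε₄ + Cε₅) + Mε₅/(2κ). Suppose 0 < γ ≤ min{1, ((1 − c_x)/m_x)ε₄, ((1 − c_y)/m_y)ε₅} and 0 < η̂ ≤ min{ (s/(3M))·(γ/μ), γ/L,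 √(ε₂/12)·sγ/(√(2nε₁ + 2ε₂ + ε₃)·L), √(ε₃/36)·sγ/(√(2nε₁ + 2ε₂ + ε₃)·L) }. Set ρ̃ = 1 − sγ and let A be the nonnegative 5×5 matrix with rows: row 1 = (1 − (3/2)Mη̂μ, 6η̂L²/(μn), 6η̂/(μnM), 0, 0); row 2 = (4nL²η̂²/(sγ), (1 + ρ̃²)/2 + 4L²η̂²/(sγ), 2η̂²/(sγ), 2Cλγ/s, 0); row 3 = (12nL⁴η̂²/(sγ), 12L⁴η̂²/(sγ) + 6λL²γ/s, (1 + ρ̃²)/2 + 6L²η̂²/(sγ), 6CλL²γ/s, 2Cλγ/s); row 4 = (2t_x nL²η̂², 2t_x L²η̂² + t_xλγ², t_x η̂², c_x + t_x Cλγ², 0); row 5 = (6t_y nL⁴η̂², 6t_y L⁴η̂² + 3t_yλL²γ², t_yλγ² + 3t_y L²η̂², 3t_y CλL²γ², c_y + t_y Cλγ²). Then the positive vector 𝛆 = (ε₁, ε₂, L²ε₃, ε₄, L²ε₅)ᵀ satisfies A𝛆 ≤ (1 − (1/2)Mη̂μ)𝛆 componentwise, and consequently the spectral radius of A (the maximum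 modulus of its complex eigenvalues) is at most 1 − (1/2)Mη̂μ. -/
/-- Collatz-Wielandt bound: if a nonnegative matrix `A` and a positive vector `v` satisfy
`A v ≤ c v`, then every complex eigenvalue of `A` has modulus at most `c`. -/
theorem norm_le_of_mem_spectrum_of_mulVec_le {ι : Type*} [Fintype ι] [DecidableEq ι]
    {A : Matrix ι ι ℝ} {v : ι → ℝ} {c : ℝ} (hA : ∀ i j, 0 ≤ A i j) (hv : ∀ i, 0 < v i)
    (h : ∀ i, A.mulVec v i ≤ c * v i) {z : ℂ}
    (hz : z ∈ spectrum ℂ (A.map (algebraMap ℝ ℂ))) : ‖z‖ ≤ c := by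
  rw [← Matrix.spectrum_toLin', ← Module.End.hasEigenvalue_iff_mem_spectrum] at hz
  obtain ⟨x, hx⟩ := hz.exists_hasEigenvector
  have hxz := hx.apply_eq_smul
  obtain ⟨k, hk⟩ := Function.ne_iff.mp hx.2
  obtain ⟨i, -, hi⟩ := Finset.exists_max_image Finset.univ (fun i => ‖x i‖ / v i)
    ⟨k, Finset.mem_univ k⟩
  have hm : ∀ j, ‖x j‖ ≤ ‖x i‖ / v i * v j := fun j =>
    (div_le_iff₀ (hv j)).mp (hi j (Finset.mem_univ j))
  have hxi : 0 < ‖x i‖ := by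
    have hpos : 0 < ‖x i‖ / v i :=
      (div_pos (norm_pos_iff.mpr hk) (hv k)).trans_le (hi k (Finset.mem_univ k))
    exact (div_pos_iff_of_pos_right (hv i)).mp hpos
  have hzi := congrFun hxz i
  simp only [Matrix.toLin'_apply, Matrix.mulVec, dotProduct, Matrix.map_apply,
    Pi.smul_apply, smul_eq_mul] at hzi
  refine le_of_mul_le_mul_right ?_ hxi
  calc ‖z‖ * ‖x i‖ = ‖∑ j, algebraMap ℝ ℂ (A i j) * x j‖ := by rw [hzi, norm_mul]
    _ ≤ ∑ j, ‖algebraMap ℝ ℂ (A i j) * x j‖ := norm_sum_le _ _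
    _ = ∑ j, A i j * ‖x j‖ := by
      refine Finset.sum_congr rfl fun j _ => ?_
      rw [norm_mul, norm_algebraMap', Real.norm_of_nonneg (hA i j)]
    _ ≤ ∑ j, A i j * (‖x i‖ / v i * v j) :=
      Finset.sum_le_sum fun j _ => mul_le_mul_of_nonneg_left (hm j) (hA i j)
    _ = ‖x i‖ / v i * A.mulVec v i := by
      simp only [Matrix.mulVec, dotProduct, Finset.mul_sum]
      exact Finset.sum_congr rfl fun j _ => by ring
    _ ≤ ‖x i‖ / v i * (c * v i) :=
      mul_le_mul_of_nonneg_left (h i) (div_nonneg hxi.le (hv i).le)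
    _ = c * ‖x i‖ := by field_simp [(hv i).ne']

/-- A step-size bound `η ≤ √a · t / (√S · L)` in squared form. -/
theorem sq_mul_le_of_le_sqrt_div {a S L t η : ℝ} (ha : 0 ≤ a) (hS : 0 < S) (hL : 0 < L)
    (hη : 0 ≤ η) (h : η ≤ √a * t / (√S * L)) : L ^ 2 * η ^ 2 * S ≤ a * t ^ 2 := by
  have h' : η * (√S * L) ≤ √a * t := (le_div_iff₀ (by positivity)).mp h
  have hsq := pow_le_pow_left₀ (by positivity) h' 2
  simp only [mul_pow, Real.sq_sqrt hS.le, Real.sq_sqrt ha] at hsq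
  linarith

/-- The row inequality for the consensus and gradient tracking errors, with `u = sγ`. -/
theorem consensus_row_le {u b e P Q : ℝ} (hu0 : 0 ≤ u) (hu1 : u ≤ 1) (he : 0 ≤ e)
    (hb : b ≤ u / 3) (hP : P ≤ u * e / 6) (hQ : Q ≤ u * e / 6) :
    P + (1 + (1 - u) ^ 2) / 2 * e + Q ≤ (1 - 1 / 2 * b) * e := by
  have h1 : b * e ≤ u / 3 * e := mul_le_mul_of_nonneg_right hb he
  have h2 : u * u * e ≤ u * 1 * e :=
    mul_le_mul_of_nonneg_right (mul_le_mul_of_nonneg_left hu1 hu0) he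
  linarith

/-- The row inequality for the compression errors. -/
theorem compression_row_le {t S R γ c e b d m q : ℝ} (ht : 0 ≤ t) (hS : 0 ≤ S) (hR : 0 ≤ R)
    (he : 0 ≤ e) (hγ0 : 0 ≤ γ) (hγ1 : γ ≤ 1) (hm : 0 < m) (hmdef : m = t * S + R + d * e / 2)
    (hγm : γ ≤ (1 - c) / m * e) (hb : b ≤ γ * d) (hq : q ≤ γ ^ 2) :
    t * q * S + γ ^ 2 * R + c * e ≤ (1 - 1 / 2 * b) * e := by
  have h1 : γ * m ≤ (1 - c) * e := by
    rw [div_mul_eq_mul_div] at hγm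
    exact (le_div_iff₀ hm).mp hγm
  have h2 : γ ^ 2 ≤ γ := by nlinarith
  have h3 : t * S * q ≤ t * S * γ := mul_le_mul_of_nonneg_left (hq.trans h2) (by positivity)
  have h4 : γ ^ 2 * R ≤ γ * R := mul_le_mul_of_nonneg_right h2 hR
  have h5 : b * e ≤ γ * d * e := mul_le_mul_of_nonneg_right hb he
  rw [hmdef] at h1
  linarith


/-- the coefficient matrix `A` of the C-GT error recursion satisfies
`Aε ≤ (1 - (1/2)Mη̂μ)ε` for the positive vector `ε = (ε₁, ε₂, L²ε₃, ε₄, L²ε₅)`, and hence its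
spectral radius (max modulus of complex eigenvalues) is at most `1 - (1/2)Mη̂μ`. -/
theorem stmt19 (n : ℕ) (μ L M κ C lam s δ r αx αy τx τy cx cy tx ty : ℝ)
    (ε1 ε2 ε3 ε4 ε5 mx my γ ηh ρt : ℝ)
    (hn : 0 < n) (hμ : 0 < μ) (hL : 0 < L) (hM : 0 < M)
    (hκ : κ = L / μ) (hC : 0 ≤ C) (hlam : 0 ≤ lam)
    (hs0 : 0 < s) (hs1 : s ≤ 1) (hδ0 : 0 < δ) (hδ1 : δ ≤ 1) (hr : 0 < r)
    (hαx0 : 0 < αx * r) (hαx1 : αx * r ≤ 1)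
    (hαy0 : 0 < αy * r) (hαy1 : αy * r ≤ 1)
    (hτx : 1 < τx) (hτy : 1 < τy)
    (hcx : cx = τx * (1 - αx * r * δ)) (hcx1 : cx < 1)
    (hcy : cy = τy * (1 - αy * r * δ)) (hcy1 : cy < 1)
    (htx : tx = 3 * τx / (τx - 1)) (hty : ty = 3 * τy / (τy - 1))
    (hε1 : 0 < ε1) (hε2 : 0 < ε2) (hε3 : 0 < ε3) (hε4 : 0 < ε4) (hε5 : 0 < ε5)
    (hc1 : (12 * κ ^ 2 / M ^ 2) * ε3 ≤ (n : ℝ) * ε1)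
    (hc2 : (12 * C * lam / s ^ 2) * ε4 ≤ ε2)
    (hc3 : M * ε2 ≤ ε3)
    (hc4 : (12 * lam * (3 * ε2 + C * (3 * ε4 + ε5))) / s ^ 2 ≤ ε3)
    (hmx : mx = tx * (2 * (n : ℝ) * ε1 + 2 * ε2 + ε3) + tx * lam * (ε2 + C * ε4)
        + M * ε4 / (2 * κ))
    (hmy : my = 3 * ty * (2 * (n : ℝ) * ε1 + 2 * ε2 + ε3)
        + ty * lam * (3 * ε2 + ε3 + 3 * C * ε4 + C * ε5) + M * ε5 / (2 * κ))
    (hγ0 : 0 < γ) (hγ1 : γ ≤ 1)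
    (hγ2 : γ ≤ ((1 - cx) / mx) * ε4) (hγ3 : γ ≤ ((1 - cy) / my) * ε5)
    (hη0 : 0 < ηh)
    (hηa : ηh ≤ (s / (3 * M)) * (γ / μ))
    (hηb : ηh ≤ γ / L)
    (hηc : ηh ≤ Real.sqrt (ε2 / 12) * (s * γ)
        / (Real.sqrt (2 * (n : ℝ) * ε1 + 2 * ε2 + ε3) * L))
    (hηd : ηh ≤ Real.sqrt (ε3 / 36) * (s * γ)
        / (Real.sqrt (2 * (n : ℝ) * ε1 + 2 * ε2 + ε3) * L))
    (hρt : ρt = 1 - s * γ)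
    (A : Matrix (Fin 5) (Fin 5) ℝ)
    (hA : A = !![
      1 - (3 / 2) * M * ηh * μ, 6 * ηh * L ^ 2 / (μ * (n : ℝ)), 6 * ηh / (μ * (n : ℝ) * M), 0, 0;
      4 * (n : ℝ) * L ^ 2 * ηh ^ 2 / (s * γ), (1 + ρt ^ 2) / 2 + 4 * L ^ 2 * ηh ^ 2 / (s * γ),
        2 * ηh ^ 2 / (s * γ), 2 * C * lam * γ / s, 0;
      12 * (n : ℝ) * L ^ 4 * ηh ^ 2 / (s * γ),
        12 * L ^ 4 * ηh ^ 2 / (s * γ) + 6 * lam * L ^ 2 * γ / s,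
        (1 + ρt ^ 2) / 2 + 6 * L ^ 2 * ηh ^ 2 / (s * γ),
        6 * C * lam * L ^ 2 * γ / s, 2 * C * lam * γ / s;
      2 * tx * (n : ℝ) * L ^ 2 * ηh ^ 2, 2 * tx * L ^ 2 * ηh ^ 2 + tx * lam * γ ^ 2,
        tx * ηh ^ 2, cx + tx * C * lam * γ ^ 2, 0;
      6 * ty * (n : ℝ) * L ^ 4 * ηh ^ 2, 6 * ty * L ^ 4 * ηh ^ 2 + 3 * ty * lam * L ^ 2 * γ ^ 2,
        ty * lam * γ ^ 2 + 3 * ty * L ^ 2 * ηh ^ 2, 3 * ty * C * lam * L ^ 2 * γ ^ 2,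
        cy + ty * C * lam * γ ^ 2])
    (εv : Fin 5 → ℝ) (hεv : εv = ![ε1, ε2, L ^ 2 * ε3, ε4, L ^ 2 * ε5]) :
    (∀ i, A.mulVec εv i ≤ (1 - (1 / 2) * M * ηh * μ) * εv i)
    ∧ (∀ z ∈ spectrum ℂ (A.map (algebraMap ℝ ℂ)), ‖z‖ ≤ 1 - (1 / 2) * M * ηh * μ) := by
  have hn' : (0 : ℝ) < n := Nat.cast_pos.mpr hn
  have hκ0 : 0 < κ := hκ ▸ div_pos hL hμ
  have htx0 : 0 < tx := htx ▸ div_pos (by linarith) (by linarith)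
  have hty0 : 0 < ty := hty ▸ div_pos (by linarith) (by linarith)
  have hcx0 : 0 ≤ cx := by
    rw [hcx]
    exact mul_nonneg (by linarith) (sub_nonneg.mpr (mul_le_one₀ hαx1 hδ0.le hδ1))
  have hcy0 : 0 ≤ cy := by
    rw [hcy]
    exact mul_nonneg (by linarith) (sub_nonneg.mpr (mul_le_one₀ hαy1 hδ0.le hδ1))
  have hu0 : 0 < s * γ := mul_pos hs0 hγ0
  have hu1 : s * γ ≤ 1 := mul_le_one₀ hs1 hγ0.le hγ1
  have hβ : M * ηh * μ ≤ s * γ / 3 := by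
    calc M * ηh * μ ≤ M * (s / (3 * M) * (γ / μ)) * μ := by gcongr
      _ = s * γ / 3 := by field_simp
  have hLη : L * ηh ≤ γ := by
    rw [mul_comm]
    exact (le_div_iff₀ hL).mp hηb
  have hLη2 : L ^ 2 * ηh ^ 2 ≤ γ ^ 2 := by
    rw [← mul_pow]
    exact pow_le_pow_left₀ (by positivity) hLη 2
  have hβκ : M * ηh * μ ≤ γ * (M / κ) := by
    calc M * ηh * μ ≤ M * (γ / L) * μ := by gcongr
      _ = γ * (M / κ) := by rw [hκ]; field_simp
  have hS : 0 < 2 * (n : ℝ) * ε1 + 2 * ε2 + ε3 := by positivity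
  have h2 := sq_mul_le_of_le_sqrt_div (by positivity) hS hL hη0.le hηc
  have h3 := sq_mul_le_of_le_sqrt_div (by positivity) hS hL hη0.le hηd
  have hrow : ∀ i, A.mulVec εv i ≤ (1 - (1 / 2) * M * ηh * μ) * εv i := by
    have r1 : 6 * ηh * L ^ 2 / (μ * n) * ε2 + 6 * ηh / (μ * n * M) * (L ^ 2 * ε3)
        ≤ M * ηh * μ * ε1 := by
      have hε : ε2 ≤ ε3 / M := (le_div_iff₀ hM).mpr (by linarith)
      calc 6 * ηh * L ^ 2 / (μ * n) * ε2 + 6 * ηh / (μ * n * M) * (L ^ 2 * ε3)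
          ≤ 6 * ηh * L ^ 2 / (μ * n) * (ε3 / M) + 6 * ηh / (μ * n * M) * (L ^ 2 * ε3) := by
            gcongr
        _ = M * ηh * μ / n * (12 * κ ^ 2 / M ^ 2 * ε3) := by
            rw [hκ]
            field_simp
            ring
        _ ≤ M * ηh * μ / n * (n * ε1) := by gcongr
        _ = M * ηh * μ * ε1 := by field_simp
    have r2 := consensus_row_le (P := 2 * (L ^ 2 * ηh ^ 2
          * (2 * (n : ℝ) * ε1 + 2 * ε2 + ε3)) / (s * γ))
        (Q := 2 * C * lam * γ / s * ε4) hu0.le hu1 hε2.le hβ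
      (by rw [div_le_iff₀ hu0]; linarith)
      (by
        calc 2 * C * lam * γ / s * ε4 = s * γ / 6 * (12 * C * lam / s ^ 2 * ε4) := by
              field_simp; ring
          _ ≤ s * γ / 6 * ε2 := by gcongr
          _ = s * γ * ε2 / 6 := by ring)
    have r3 := consensus_row_le (P := 6 * (L ^ 2 * ηh ^ 2
          * (2 * (n : ℝ) * ε1 + 2 * ε2 + ε3)) / (s * γ))
        (Q := 2 * lam * γ / s * (3 * ε2 + C * (3 * ε4 + ε5))) hu0.le hu1 hε3.le hβ
      (by rw [div_le_iff₀ hu0]; linarith)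
      (by
        calc 2 * lam * γ / s * (3 * ε2 + C * (3 * ε4 + ε5))
            = s * γ / 6 * (12 * lam * (3 * ε2 + C * (3 * ε4 + ε5)) / s ^ 2) := by
              field_simp; ring
          _ ≤ s * γ / 6 * ε3 := by gcongr
          _ = s * γ * ε3 / 6 := by ring)
    have r4 := compression_row_le (R := tx * lam * (ε2 + C * ε4)) htx0.le hS.le
      (by positivity) hε4.le hγ0.le hγ1 (by rw [hmx]; positivity)
      (hmx.trans (by field_simp)) hγ2 hβκ hLη2
    have r5 := compression_row_le (t := 3 * ty)
      (R := ty * lam * (3 * ε2 + ε3 + 3 * C * ε4 + C * ε5)) (by positivity) hS.le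
      (by positivity) hε5.le hγ0.le hγ1 (by rw [hmy]; positivity)
      (hmy.trans (by field_simp)) hγ3 hβκ hLη2
    have r3' := mul_le_mul_of_nonneg_left r3 (sq_nonneg L)
    have r5' := mul_le_mul_of_nonneg_left r5 (sq_nonneg L)
    subst hA hεv hρt
    intro i
    fin_cases i <;>
      simp only [Matrix.mulVec, dotProduct, Fin.sum_univ_five, Matrix.of_apply, Matrix.cons_val',
        Matrix.cons_val, Matrix.cons_val_zero, Matrix.cons_val_one, Fin.zero_eta, Fin.mk_one,
        Fin.reduceFinMk]
    · linarith
    · refine le_trans (le_of_eq ?_) (r2.trans_eq (by ring))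
      ring
    · refine le_trans (le_of_eq ?_) (r3'.trans_eq (by ring))
      ring
    · refine le_trans (le_of_eq ?_) (r4.trans_eq (by ring))
      ring
    · refine le_trans (le_of_eq ?_) (r5'.trans_eq (by ring))
      ring
  refine ⟨hrow, fun z hz => norm_le_of_mem_spectrum_of_mulVec_le ?_ ?_ hrow hz⟩
  · have h11 : 0 ≤ 1 - 3 / 2 * M * ηh * μ := by linarith
    subst hA
    clear * - h11 hC hlam hs0 hγ0 hη0 hL hμ hM hn' htx0 hty0 hcx0 hcy0
    intro i j
    fin_cases i <;> fin_cases j <;>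
      simp only [Matrix.of_apply, Matrix.cons_val', Matrix.cons_val, Matrix.cons_val_zero,
        Matrix.cons_val_one, Fin.zero_eta, Fin.mk_one, Fin.reduceFinMk] <;>
      first | exact h11 | positivity
  · subst hεv
    intro i
    fin_cases i <;> simp <;> positivity
end
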